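/- With A = Σ_{t=1}^n d_t d_tᵀ, the matrix λI + A is invertible, and for every index i ∈ {1,…,N} such that the i-th entry of d_n equals 1, the standard basis vector e_i satisfies e_iᵀ (λI + A)⁻¹ e_i ≤ 1/(1/4 + λ). -/

import Mathlib

open Matrix BigOperators

/-- If `f ≤ g` are `{0,1}`-vectors, `g i = 1`, `f i = 0` and the support of `g` has one more element
than that of `f`, then `g = f + e_i`. -/
lemma eq_add_single_of_card_support_succ {N : ℕ} {f g : Fin N → ℝ} {i : Fin N} {k : ℕ}
    (hf : ∀ j, f j = 0 ∨ f j = 1) (hg : ∀ j, g j = 0 ∨ g j = 1)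
    (hfg : ∀ j, f j = 1 → g j = 1) (hfi : f i ≠ 1) (hgi : g i = 1)
    (hfc : (Finset.univ.filter (fun j => f j = 1)).card = k)
    (hgc : (Finset.univ.filter (fun j => g j = 1)).card = k + 1) :
    g = f + Pi.single i 1 := by
  have hins : insert i (Finset.univ.filter (fun j => f j = 1)) =
      Finset.univ.filter (fun j => g j = 1) := by
    apply Finset.eq_of_subset_of_card_le
    · intro j hj
      simp only [Finset.mem_insert, Finset.mem_filter, Finset.mem_univ, true_and] at hj ⊢
      rcases hj with rfl | hj
      · exact hgi
      · exact hfg j hj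
    · rw [Finset.card_insert_of_notMem (by simpa using hfi), hfc, hgc]
  ext j
  have hj : (j = i ∨ f j = 1) ↔ g j = 1 := by
    simpa using Finset.ext_iff.mp hins j
  by_cases hji : j = i
  · subst hji
    simp [hgi, (hf j).resolve_right hfi]
  · rcases hf j with h | h <;> rcases hg j with h' | h' <;> simp_all

/-- For a chain of nested `{0,1}`-vectors with supports of sizes `1, …, n`, a coordinate in the
support of some member is controlled by the sum of squared pairings with the chain. -/
lemma sq_div_four_le_sum_sq_dotProduct {N n : ℕ} {d : Fin n → Fin N → ℝ}
    (h01 : ∀ t i, d t i = 0 ∨ d t i = 1)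
    (hcard : ∀ t : Fin n,
      (Finset.univ.filter (fun i : Fin N => d t i = 1)).card = (t : ℕ) + 1)
    (hmono : ∀ (t : Fin n) (hlt : (t : ℕ) + 1 < n) (i : Fin N),
      d t i = 1 → d ⟨(t : ℕ) + 1, hlt⟩ i = 1)
    {i : Fin N} {s : Fin n} (hi : d s i = 1) (x : Fin N → ℝ) :
    x i ^ 2 / 4 ≤ ∑ t, (d t ⬝ᵥ x) ^ 2 := by
  obtain ⟨s, hs⟩ := s
  induction s with
  | zero =>
    have h := eq_add_single_of_card_support_succ (f := 0) (k := 0) (by simp) (h01 ⟨0, hs⟩)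
      (by simp) (by simp) hi (by simp) (hcard ⟨0, hs⟩)
    have hle := Finset.single_le_sum (f := fun t => (d t ⬝ᵥ x) ^ 2)
      (fun t _ => sq_nonneg _) (Finset.mem_univ (⟨0, hs⟩ : Fin n))
    have hx : d ⟨0, hs⟩ ⬝ᵥ x = x i := by simp [h]
    simp only [hx] at hle
    linarith [sq_nonneg (x i)]
  | succ k ih =>
    have hk : k < n := by omega
    by_cases hki : d ⟨k, hk⟩ i = 1
    · exact ih hk hki
    · have h := eq_add_single_of_card_support_succ (h01 ⟨k, hk⟩) (h01 ⟨k + 1, hs⟩)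
        (hmono ⟨k, hk⟩ hs) hki hi (hcard ⟨k, hk⟩) (hcard ⟨k + 1, hs⟩)
      have hle := Finset.add_le_sum (f := fun t => (d t ⬝ᵥ x) ^ 2)
        (fun t _ => sq_nonneg _) (Finset.mem_univ (⟨k, hk⟩ : Fin n))
        (Finset.mem_univ (⟨k + 1, hs⟩ : Fin n)) (by simp)
      have hx : d ⟨k + 1, hs⟩ ⬝ᵥ x = d ⟨k, hk⟩ ⬝ᵥ x + x i := by simp [h, add_dotProduct]
      simp only [hx] at hle
      nlinarith [sq_nonneg (2 * (d ⟨k, hk⟩ ⬝ᵥ x) + x i)]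

/-- A lower bound `c * x i ^ 2 ≤ xᵀ M x` bounds the `i`-th diagonal entry of `M⁻¹` by `1 / c`. -/
lemma single_dotProduct_inv_mulVec_single_le {N : ℕ} {M : Matrix (Fin N) (Fin N) ℝ}
    (hM : IsUnit M) {c : ℝ} (hc : 0 < c) {i : Fin N}
    (h : ∀ x : Fin N → ℝ, c * x i ^ 2 ≤ x ⬝ᵥ (M *ᵥ x)) :
    (Pi.single i 1 : Fin N → ℝ) ⬝ᵥ (M⁻¹ *ᵥ (Pi.single i 1 : Fin N → ℝ)) ≤ 1 / c := by
  have hu := h (M⁻¹ *ᵥ Pi.single i 1)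
  rw [mulVec_mulVec, mul_nonsing_inv _ ((isUnit_iff_isUnit_det M).mp hM), one_mulVec,
    dotProduct_single_one] at hu
  rw [single_one_dotProduct, le_div_iff₀ hc]
  by_contra! hlt
  nlinarith [pos_of_mul_pos_left (one_pos.trans hlt) hc.le]



/-- Let `d_1, …, d_n ∈ ℝ^N` be `{0,1}`-vectors with `|supp d_t| = t`
and `supp d_t ⊆ supp d_{t+1}` (here `t : Fin n` is zero-indexed, so `|supp (d t)| = t+1`).
With `A = Σ_t d_t d_tᵀ` and `λ > 0`, the matrix `λI + A` is invertible, and for every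
coordinate `i` with `(d_n)_i = 1` the standard basis vector `e_i` satisfies
`e_iᵀ (λI + A)⁻¹ e_i ≤ 1/(1/4 + λ)`. -/
theorem inverse_quadratic_form_bound_nested_supports (N n : ℕ) (hn : 0 < n) (hnN : n ≤ N)
    (lam : ℝ) (hlam : 0 < lam)
    (d : Fin n → Fin N → ℝ)
    (h01 : ∀ (t : Fin n) (i : Fin N), d t i = 0 ∨ d t i = 1)
    (hcard : ∀ t : Fin n,
      (Finset.univ.filter (fun i : Fin N => d t i = 1)).card = (t : ℕ) + 1)
    (hmono : ∀ (t : Fin n) (hlt : (t : ℕ) + 1 < n) (i : Fin N),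
      d t i = 1 → d ⟨(t : ℕ) + 1, hlt⟩ i = 1)
    (A : Matrix (Fin N) (Fin N) ℝ)
    (hA : A = ∑ t : Fin n, Matrix.vecMulVec (d t) (d t)) :
    IsUnit (lam • (1 : Matrix (Fin N) (Fin N) ℝ) + A) ∧
    ∀ i : Fin N, d ⟨n - 1, Nat.sub_lt hn one_pos⟩ i = 1 →
      (Pi.single i 1 : Fin N → ℝ) ⬝ᵥ
          ((lam • (1 : Matrix (Fin N) (Fin N) ℝ) + A)⁻¹ *ᵥ (Pi.single i 1 : Fin N → ℝ))
        ≤ 1 / (1 / 4 + lam) := by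
  have hpos : (lam • (1 : Matrix (Fin N) (Fin N) ℝ) + A).PosDef := by
    rw [hA]
    refine (PosDef.one.smul hlam).add_posSemidef (posSemidef_sum _ fun t _ => ?_)
    simpa using posSemidef_vecMulVec_self_star (d t)
  refine ⟨hpos.isUnit, fun i hi =>
    single_dotProduct_inv_mulVec_single_le hpos.isUnit (by linarith) fun x => ?_⟩
  have hquad : x ⬝ᵥ ((lam • (1 : Matrix (Fin N) (Fin N) ℝ) + A) *ᵥ x) =
      lam * (x ⬝ᵥ x) + ∑ t, (d t ⬝ᵥ x) ^ 2 := by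
    rw [add_mulVec, smul_mulVec, one_mulVec, dotProduct_add, dotProduct_smul, smul_eq_mul, hA,
      sum_mulVec, dotProduct_sum]
    congr 1
    refine Finset.sum_congr rfl fun t _ => ?_
    rw [vecMulVec_mulVec, op_smul_eq_smul, dotProduct_smul, smul_eq_mul, dotProduct_comm x, sq]
  have hsq : x i ^ 2 ≤ x ⬝ᵥ x := by
    rw [sq]
    exact Finset.single_le_sum (f := fun j => x j * x j) (fun j _ => mul_self_nonneg _)
      (Finset.mem_univ i)
  rw [hquad]
  linarith [sq_div_four_le_sum_sq_dotProduct h01 hcard hmono hi x,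
    mul_le_mul_of_nonneg_left hsq hlam.le]
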